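/- Let Y be a random variable taking values in [0,∞) with distribution function G having finite moments of all positive integer orders, such that G is absolutely continuous on [x₀,∞) for some x₀ > e, with density g(x) = G′(x) > 0 there. Let a > 0 and α ∈ [0,1). If limsup_{x→∞} g((x + a·(log x)^α · log log x)²) / g(x²) < 1, then G is uniquely determined by its moments among all probability distributions on [0,∞). -/

import Mathlib

open MeasureTheory Filter Set

/-- Moment-determinacy on `ℝ₊` among all probability distributions on `[0,∞)`. -/
def IsMomentDetOnNonneg (μ : Measure ℝ) : Prop :=
  ∀ ν : Measure ℝ, IsProbabilityMeasure ν → ν (Set.Iio 0) = 0 →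
    (∀ n : ℕ, 0 < n → Integrable (fun x => x ^ n) ν ∧
      ∫ x, x ^ n ∂ν = ∫ x, x ^ n ∂μ) → ν = μ

/-- One step of Bang's method: bounds on all derivatives up to order `N` deteriorate by at most a
factor `e` along an interval of length `1 / (e w)`. -/
lemma norm_le_of_norm_le_of_derivChain {E : Type*} [NormedAddCommGroup E] [NormedSpace ℝ E]
    {F : ℕ → ℝ → E} (hF : ∀ n t, HasDerivAt (F n) (F (n + 1) t) t)
    {M : ℕ → ℝ} {N : ℕ} {w D x h : ℝ} (hM : ∀ n, 0 ≤ M n) (hw : 0 < w) (hD : 0 ≤ D)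
    (hMw : ∀ n < N, M (n + 1) ≤ w * M n)
    (htop : ∀ t, ‖F N t‖ ≤ D * Real.exp N * M N)
    (hx : ∀ n ≤ N, ‖F n x‖ ≤ D * Real.exp n * M n)
    (hh : 0 ≤ h) {n : ℕ} (hn : n ≤ N) :
    ‖F n (x + h)‖ ≤ D * Real.exp n * M n * Real.exp (Real.exp 1 * w * h) := by
  induction hn using Nat.decreasingInduction generalizing h with
  | self =>
    refine (htop _).trans (le_mul_of_one_le_right ?_ (Real.one_le_exp (by positivity)))
    have := hM N
    positivity
  | of_succ k hk ih =>
    have key := image_norm_le_of_norm_deriv_right_le_deriv_boundary (f := fun s => F k (x + s))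
      (f' := fun s => F (k + 1) (x + s)) (a := 0) (b := h)
      (B := fun s => D * Real.exp k * M k * Real.exp (Real.exp 1 * w * s))
      (B' := fun s => D * Real.exp k * M k * (Real.exp (Real.exp 1 * w * s) * (Real.exp 1 * w)))
      (fun s _ => ((hF k (x + s)).comp_const_add x s).continuousAt.continuousWithinAt)
      (fun s _ => ((hF k (x + s)).comp_const_add x s).hasDerivWithinAt)
      (by simpa using hx k hk.le)
      (fun s => by
        have := ((hasDerivAt_id s).const_mul (Real.exp 1 * w)).exp.const_mul
          (D * Real.exp k * M k)
        simpa using this)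
      (fun s hs => by
        refine (ih hs.1).trans ?_
        have h1 := mul_le_mul_of_nonneg_left (hMw k hk)
          (by positivity : 0 ≤ D * Real.exp k * Real.exp 1 * Real.exp (Real.exp 1 * w * s))
        push_cast
        rw [Real.exp_add]
        linarith)
    exact key ⟨hh, le_rfl⟩

/-- Denjoy–Carleman quasi-analyticity, in Bang's form. -/
theorem eq_zero_of_derivChain {E : Type*} [NormedAddCommGroup E] [NormedSpace ℝ E]
    {F : ℕ → ℝ → E} (hF : ∀ n t, HasDerivAt (F n) (F (n + 1) t) t)
    {M w : ℕ → ℝ} {C : ℝ} (hM : ∀ n, 0 ≤ M n) (hC : 0 ≤ C)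
    (hw : ∀ n, 0 < w n) (hwm : Monotone w) (hws : ¬ Summable fun n => (w n)⁻¹)
    (hMw : ∀ n, M (n + 1) ≤ w n * M n) (hb : ∀ n t, ‖F n t‖ ≤ C * M n)
    (h0 : ∀ n, F n 0 = 0) {x : ℝ} (hx : 0 ≤ x) : F 0 x = 0 := by
  have he : 0 < Real.exp 1 := Real.exp_pos 1
  have step (K : ℕ) (y h : ℝ) (hh : 0 ≤ h) (hh' : h ≤ (w K)⁻¹ / Real.exp 1)
      (hy : ∀ n ≤ K + 1, ‖F n y‖ ≤ C * Real.exp (-(K + 1 : ℕ)) * Real.exp n * M n) :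
      ∀ n ≤ K, ‖F n (y + h)‖ ≤ C * Real.exp (-K) * Real.exp n * M n := by
    intro n hn
    have h1 := norm_le_of_norm_le_of_derivChain hF (D := C * Real.exp (-(K + 1 : ℕ))) hM (hw K)
      (by positivity)
      (fun m hm => (hMw m).trans
        (mul_le_mul_of_nonneg_right (hwm (by lia : m ≤ K)) (hM m)))
      (fun t => by
        refine (hb _ t).trans_eq ?_
        rw [mul_assoc C, ← Real.exp_add]; simp)
      hy hh (hn.trans K.le_succ)
    refine h1.trans ?_
    have h2 : Real.exp 1 * w K * h ≤ 1 := by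
      have := hw K
      calc Real.exp 1 * w K * h ≤ Real.exp 1 * w K * ((w K)⁻¹ / Real.exp 1) := by gcongr
        _ = 1 := by field_simp
    have h3 : Real.exp (-(K + 1 : ℕ)) * Real.exp (Real.exp 1 * w K * h) ≤ Real.exp (-K) := by
      rw [← Real.exp_add]
      apply Real.exp_le_exp.2
      push_cast
      linarith
    have := hM n
    calc _ = C * (Real.exp (-(K + 1 : ℕ)) * Real.exp (Real.exp 1 * w K * h)) * Real.exp n * M n :=
          by ring
      _ ≤ _ := by gcongr
  have main (j : ℕ) : ∀ (K : ℕ) (y : ℝ), 0 ≤ y →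
      y ≤ (∑ k ∈ Finset.range j, (w (K + k))⁻¹) / Real.exp 1 →
      ∀ n ≤ K, ‖F n y‖ ≤ C * Real.exp (-K) * Real.exp n * M n := by
    induction j with
    | zero =>
      intro K y hy hy' n hn
      obtain rfl : y = 0 := le_antisymm (by simpa using hy') hy
      have := hM n
      rw [h0, norm_zero]
      positivity
    | succ j ih =>
      intro K y hy hy'
      rw [Finset.sum_range_succ', add_zero, add_div] at hy'
      have hpos : 0 ≤ (w K)⁻¹ / Real.exp 1 := by have := hw K; positivity
      have hsum : 0 ≤ (∑ k ∈ Finset.range j, (w (K + 1 + k))⁻¹) / Real.exp 1 :=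
        div_nonneg (Finset.sum_nonneg fun k _ => (inv_pos.2 (hw _)).le) he.le
      have hsum' : (∑ k ∈ Finset.range j, (w (K + (k + 1)))⁻¹)
          = ∑ k ∈ Finset.range j, (w (K + 1 + k))⁻¹ :=
        Finset.sum_congr rfl fun k _ => by rw [add_right_comm, add_assoc]
      rw [hsum'] at hy'
      rcases le_total y ((w K)⁻¹ / Real.exp 1) with hc | hc
      · simpa using step K 0 y hy hc (ih (K + 1) 0 le_rfl hsum)
      · have := step K (y - (w K)⁻¹ / Real.exp 1) _ hpos le_rfl
          (ih (K + 1) _ (by linarith) (by linarith))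
        simpa using this
  have hall (K : ℕ) : ‖F 0 x‖ ≤ C * Real.exp (-K) * M 0 := by
    have hns : ¬ Summable fun k => (w (K + k))⁻¹ := by
      simpa only [add_comm K] using mt (summable_nat_add_iff K).1 hws
    have ht := (not_summable_iff_tendsto_nat_atTop_of_nonneg
      (fun k => (inv_pos.2 (hw (K + k))).le)).1 hns
    obtain ⟨j, hj⟩ := (ht.eventually_ge_atTop (x * Real.exp 1)).exists
    simpa using main j K x hx ((le_div_iff₀ he).2 hj) 0 K.zero_le
  have hlim : Tendsto (fun K : ℕ => C * Real.exp (-K) * M 0) atTop (nhds (C * 0 * M 0)) :=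
    ((Real.tendsto_exp_neg_atTop_nhds_zero.comp tendsto_natCast_atTop_atTop).const_mul C).mul_const _
  simpa using ge_of_tendsto' hlim hall

lemma memLp_id_of_integrable_pow {ρ : Measure ℝ} [IsFiniteMeasure ρ] {n : ℕ}
    (h : Integrable (fun x : ℝ => x ^ n) ρ) : MemLp id n ρ := by
  rcases eq_or_ne n 0 with rfl | hn
  · simpa using (by fun_prop : AEStronglyMeasurable (id : ℝ → ℝ) ρ)
  · rw [← integrable_norm_rpow_iff (by fun_prop) (by simpa using hn) (by simp)]
    simpa using h.norm

/-- Determinacy of the Hamburger problem under a quasi-analytic bound on absolute moments. -/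
theorem MeasureTheory.Measure.ext_of_moments_of_le {ρ σ : Measure ℝ} [IsFiniteMeasure ρ]
    [IsFiniteMeasure σ]
    (hρ : ∀ n : ℕ, Integrable (fun x : ℝ => x ^ n) ρ)
    (hσ : ∀ n : ℕ, Integrable (fun x : ℝ => x ^ n) σ)
    (heq : ∀ n : ℕ, ∫ x, x ^ n ∂ρ = ∫ x, x ^ n ∂σ)
    {M w : ℕ → ℝ} (hw : ∀ n, 0 < w n) (hwm : Monotone w) (hws : ¬ Summable fun n => (w n)⁻¹)
    (hMw : ∀ n, M (n + 1) ≤ w n * M n)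
    (hρM : ∀ n : ℕ, ∫ x, |x| ^ n ∂ρ ≤ M n) (hσM : ∀ n : ℕ, ∫ x, |x| ^ n ∂σ ≤ M n) :
    ρ = σ := by
  have smooth {τ : Measure ℝ} [IsFiniteMeasure τ]
      (hτ : ∀ n : ℕ, Integrable (fun x : ℝ => x ^ n) τ) (n : ℕ) (t : ℝ) :
      HasDerivAt (iteratedDeriv n (charFun τ)) (iteratedDeriv (n + 1) (charFun τ) t) t := by
    rw [iteratedDeriv_succ]
    exact ((contDiff_charFun (memLp_id_of_integrable_pow (hτ (n + 1)))).differentiable_iteratedDeriv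
      n (by exact_mod_cast n.lt_succ_self) t).hasDerivAt
  have bound {τ : Measure ℝ} [IsFiniteMeasure τ]
      (hτ : ∀ n : ℕ, Integrable (fun x : ℝ => x ^ n) τ) (n : ℕ) (t : ℝ) :
      ‖iteratedDeriv n (charFun τ) t‖ ≤ ∫ x, |x| ^ n ∂τ := by
    rw [iteratedDeriv_charFun (memLp_id_of_integrable_pow (hτ n)), norm_mul, norm_pow,
      Complex.norm_I, one_pow, one_mul]
    refine (norm_integral_le_integral_norm _).trans_eq (integral_congr_ae (.of_forall fun x => ?_))
    have : ‖Complex.exp (t * x * Complex.I)‖ = 1 := by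
      rw [← Complex.ofReal_mul, Complex.norm_exp_ofReal_mul_I]
    simp [this]
  have hnonneg (t : ℝ) (ht : 0 ≤ t) : charFun ρ t = charFun σ t := by
    have := eq_zero_of_derivChain
      (F := fun n t => iteratedDeriv n (charFun ρ) t - iteratedDeriv n (charFun σ) t)
      (fun n t => (smooth hρ n t).sub (smooth hσ n t)) (C := 2)
      (fun n => (integral_nonneg fun x => by positivity).trans (hρM n)) zero_le_two hw hwm hws hMw
      (fun n t => (norm_sub_le _ _).trans (by
        linarith [(bound hρ n t).trans (hρM n), (bound hσ n t).trans (hσM n)]))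
      (fun n => by
        rw [iteratedDeriv_charFun_zero (memLp_id_of_integrable_pow (hρ n)),
          iteratedDeriv_charFun_zero (memLp_id_of_integrable_pow (hσ n)), heq, sub_self]) ht
    simpa [sub_eq_zero] using this
  refine Measure.ext_of_charFun (funext fun t => ?_)
  rcases le_total 0 t with ht | ht
  · exact hnonneg t ht
  · have h := hnonneg _ (neg_nonneg.2 ht)
    rwa [charFun_neg, charFun_neg, (starRingEnd ℂ).injective.eq_iff] at h

/-- The law of `±√Y` (with total mass `2`) when `Y` has law `μ`. -/
noncomputable def symmSqrt (μ : Measure ℝ) : Measure ℝ :=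
  μ.map Real.sqrt + μ.map (fun x => -Real.sqrt x)

instance (μ : Measure ℝ) [IsFiniteMeasure μ] : IsFiniteMeasure (symmSqrt μ) := by
  unfold symmSqrt; infer_instance

lemma map_sq_symmSqrt {μ : Measure ℝ} (hμ : μ (Iio 0) = 0) :
    (symmSqrt μ).map (fun x => x ^ 2) = μ + μ := by
  have hae : ∀ᵐ x ∂μ, 0 ≤ x := by
    rw [ae_iff]; simpa [Iio] using hμ
  rw [symmSqrt, Measure.map_add _ _ (by fun_prop), Measure.map_map (by fun_prop) (by fun_prop),
    Measure.map_map (by fun_prop) (by fun_prop)]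
  congr 1
  all_goals
    conv_rhs => rw [← Measure.map_id (μ := μ)]
    refine Measure.map_congr (hae.mono fun x hx => ?_)
    simp [Real.sq_sqrt hx]

lemma integrable_sqrt_pow {μ : Measure ℝ} [IsFiniteMeasure μ]
    (h : ∀ n : ℕ, Integrable (fun x : ℝ => x ^ n) μ) (n : ℕ) :
    Integrable (fun x => Real.sqrt x ^ n) μ := by
  refine ((integrable_const 1).add (h n).norm).mono' (by fun_prop) (.of_forall fun x => ?_)
  rw [Real.norm_of_nonneg (by positivity)]
  simp only [Pi.add_apply, norm_pow, Real.norm_eq_abs]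
  rcases le_total (Real.sqrt x) 1 with hx | hx
  · have := pow_le_one₀ (n := n) (Real.sqrt_nonneg x) hx
    have : 0 ≤ |x| ^ n := by positivity
    linarith
  · have hx0 : 0 ≤ x := (Real.sqrt_pos.1 (zero_lt_one.trans_le hx)).le
    have h1 : Real.sqrt x ≤ |x| := by
      rw [abs_of_nonneg hx0]
      nlinarith [Real.sq_sqrt hx0]
    have := pow_le_pow_left₀ (Real.sqrt_nonneg x) h1 n
    linarith

lemma integrable_symmSqrt {μ : Measure ℝ} {f : ℝ → ℝ} (hf : Measurable f)
    (h₁ : Integrable (fun x => f (Real.sqrt x)) μ)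
    (h₂ : Integrable (fun x => f (-Real.sqrt x)) μ) : Integrable f (symmSqrt μ) := by
  rw [symmSqrt, integrable_add_measure, integrable_map_measure (by fun_prop) (by fun_prop),
    integrable_map_measure (by fun_prop) (by fun_prop)]
  exact ⟨h₁, h₂⟩

lemma integral_symmSqrt {μ : Measure ℝ} {f : ℝ → ℝ} (hf : Measurable f)
    (h₁ : Integrable (fun x => f (Real.sqrt x)) μ)
    (h₂ : Integrable (fun x => f (-Real.sqrt x)) μ) :
    ∫ x, f x ∂(symmSqrt μ) = ∫ x, f (Real.sqrt x) ∂μ + ∫ x, f (-Real.sqrt x) ∂μ := by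
  rw [symmSqrt, integral_add_measure, integral_map (by fun_prop) (by fun_prop),
    integral_map (by fun_prop) (by fun_prop)]
  · rwa [integrable_map_measure (by fun_prop) (by fun_prop)]
  · rwa [integrable_map_measure (by fun_prop) (by fun_prop)]

/-- Half-integer moments are controlled by products of half the square-rooted moment ratios. -/
lemma integral_sqrt_pow_le {μ : Measure ℝ} [IsProbabilityMeasure μ] (hμ : μ (Iio 0) = 0)
    (hint : ∀ n : ℕ, Integrable (fun x : ℝ => x ^ n) μ) {w : ℕ → ℝ} (hw : ∀ n, 0 < w n)
    (hr : ∀ n : ℕ, ∫ x, x ^ (n + 1) ∂μ ≤ w n ^ 2 * ∫ x, x ^ n ∂μ) (n : ℕ) :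
    ∫ x, Real.sqrt x ^ n ∂μ ≤ ∏ k ∈ Finset.range n, w (k / 2) := by
  have hae : ∀ᵐ x ∂μ, 0 ≤ x := by
    rw [ae_iff]; simpa [Iio] using hμ
  have heven (j : ℕ) : ∫ x, x ^ j ∂μ ≤ ∏ k ∈ Finset.range (2 * j), w (k / 2) := by
    induction j with
    | zero => simp
    | succ j ih =>
      rw [show 2 * (j + 1) = 2 * j + 1 + 1 by ring, Finset.prod_range_succ, Finset.prod_range_succ,
        show (2 * j + 1) / 2 = j by lia, show 2 * j / 2 = j by lia]
      calc _ ≤ w j ^ 2 * ∫ x, x ^ j ∂μ := hr j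
        _ ≤ w j ^ 2 * ∏ k ∈ Finset.range (2 * j), w (k / 2) := by gcongr
        _ = _ := by ring
  rcases n.even_or_odd' with ⟨j, rfl | rfl⟩
  · refine (integral_congr_ae (hae.mono fun x hx => ?_)).trans_le (heven j)
    simp [pow_mul, Real.sq_sqrt hx]
  · have hwj := hw j
    calc ∫ x, Real.sqrt x ^ (2 * j + 1) ∂μ
        ≤ ∫ x, (w j / 2 * x ^ j + (2 * w j)⁻¹ * x ^ (j + 1)) ∂μ := by
          refine integral_mono_ae (integrable_sqrt_pow hint _)
            (((hint j).const_mul _).add ((hint (j + 1)).const_mul _)) (hae.mono fun x hx => ?_)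
          have hs : Real.sqrt x ≤ w j / 2 + (2 * w j)⁻¹ * x := by
            have h1 := sq_nonneg (w j - Real.sqrt x)
            have h2 := Real.sq_sqrt hx
            have h3 : w j / 2 + (2 * w j)⁻¹ * x - Real.sqrt x
                = (w j - Real.sqrt x) ^ 2 / (2 * w j) := by
              rw [sub_sq, h2]; field_simp; ring
            have h4 : 0 ≤ (w j - Real.sqrt x) ^ 2 / (2 * w j) := by positivity
            linarith
          simp only [pow_succ, pow_mul, Real.sq_sqrt hx]
          calc x ^ j * Real.sqrt x ≤ x ^ j * (w j / 2 + (2 * w j)⁻¹ * x) := by gcongr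
            _ = _ := by ring
      _ = w j / 2 * ∫ x, x ^ j ∂μ + (2 * w j)⁻¹ * ∫ x, x ^ (j + 1) ∂μ := by
          rw [integral_add ((hint j).const_mul _) ((hint (j + 1)).const_mul _),
            integral_const_mul, integral_const_mul]
      _ ≤ w j / 2 * ∫ x, x ^ j ∂μ + (2 * w j)⁻¹ * (w j ^ 2 * ∫ x, x ^ j ∂μ) := by
          gcongr; exact hr j
      _ = (∫ x, x ^ j ∂μ) * w j := by field_simp; ring
      _ ≤ _ := by
          rw [Finset.prod_range_succ, show 2 * j / 2 = j by lia]
          gcongr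
          exact heven j

/-- Determinacy of the Stieltjes problem when the moment ratios `ν_{n+1}/ν_n` are at most `w n ^ 2`
with `∑ 1 / w n = ∞`. -/
theorem ext_of_moment_ratio_le {μ ν : Measure ℝ} [IsProbabilityMeasure μ] [IsProbabilityMeasure ν]
    (hμ : μ (Iio 0) = 0) (hν : ν (Iio 0) = 0)
    (hμi : ∀ n : ℕ, Integrable (fun x : ℝ => x ^ n) μ)
    (hνi : ∀ n : ℕ, Integrable (fun x : ℝ => x ^ n) ν)
    (heq : ∀ n : ℕ, ∫ x, x ^ n ∂μ = ∫ x, x ^ n ∂ν) {w : ℕ → ℝ} (hw : ∀ n, 0 < w n)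
    (hwm : Monotone w) (hws : ¬ Summable fun n => (w n)⁻¹)
    (hr : ∀ n : ℕ, ∫ x, x ^ (n + 1) ∂μ ≤ w n ^ 2 * ∫ x, x ^ n ∂μ) : μ = ν := by
  have integrable_neg {τ : Measure ℝ} [IsProbabilityMeasure τ]
      (hτ : ∀ n : ℕ, Integrable (fun x : ℝ => x ^ n) τ) (n : ℕ) :
      Integrable (fun x => (-Real.sqrt x) ^ n) τ := by
    simpa only [neg_pow (Real.sqrt _)] using (integrable_sqrt_pow hτ n).const_mul ((-1) ^ n)
  have integrable_symm {τ : Measure ℝ} [IsProbabilityMeasure τ]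
      (hτ : ∀ n : ℕ, Integrable (fun x : ℝ => x ^ n) τ) (n : ℕ) :
      Integrable (fun x => x ^ n) (symmSqrt τ) :=
    integrable_symmSqrt (by fun_prop) (integrable_sqrt_pow hτ n) (integrable_neg hτ n)
  have moment_symm {τ : Measure ℝ} [IsProbabilityMeasure τ] (hτ0 : τ (Iio 0) = 0)
      (hτ : ∀ n : ℕ, Integrable (fun x : ℝ => x ^ n) τ) (n : ℕ) :
      ∫ x, x ^ n ∂(symmSqrt τ) = if Even n then 2 * ∫ x, x ^ (n / 2) ∂τ else 0 := by
    rw [integral_symmSqrt (f := fun x => x ^ n) (by fun_prop) (integrable_sqrt_pow hτ n)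
      (integrable_neg hτ n)]
    simp only [neg_pow (Real.sqrt _), integral_const_mul]
    split_ifs with h
    · obtain ⟨j, rfl⟩ := h.two_dvd
      have : ∫ x, Real.sqrt x ^ (2 * j) ∂τ = ∫ x, x ^ j ∂τ := by
        have hae : ∀ᵐ x ∂τ, 0 ≤ x := by
          rw [ae_iff]; simpa [Iio] using hτ0
        exact integral_congr_ae (hae.mono fun x hx => by simp [pow_mul, Real.sq_sqrt hx])
      rw [this]
      simp
      ring
    · simp [(Nat.not_even_iff_odd.1 h).neg_one_pow]
  have abs_le {τ : Measure ℝ} [IsProbabilityMeasure τ] (hτ0 : τ (Iio 0) = 0)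
      (hτ : ∀ n : ℕ, Integrable (fun x : ℝ => x ^ n) τ)
      (hr : ∀ n : ℕ, ∫ x, x ^ (n + 1) ∂τ ≤ w n ^ 2 * ∫ x, x ^ n ∂τ) (n : ℕ) :
      ∫ x, |x| ^ n ∂(symmSqrt τ) ≤ 2 * ∏ k ∈ Finset.range n, w (k / 2) := by
    have h1 : ∀ x : ℝ, |Real.sqrt x| ^ n = Real.sqrt x ^ n := fun x => by
      rw [abs_of_nonneg (Real.sqrt_nonneg x)]
    rw [integral_symmSqrt (f := fun x => |x| ^ n) (by fun_prop)
      (by simpa [h1] using integrable_sqrt_pow hτ n)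
      (by simpa [abs_neg, h1] using integrable_sqrt_pow hτ n)]
    simp only [abs_neg, h1]
    linarith [integral_sqrt_pow_le hτ0 hτ hw hr n]
  have hsymm : symmSqrt μ = symmSqrt ν :=
    Measure.ext_of_moments_of_le (integrable_symm hμi) (integrable_symm hνi)
      (fun n => by rw [moment_symm hμ hμi, moment_symm hν hνi, heq])
      (w := fun k => w (k / 2)) (M := fun n => 2 * ∏ k ∈ Finset.range n, w (k / 2))
      (fun n => hw _) (fun m n h => hwm (Nat.div_le_div_right h))
      (fun h => hws (by
        simpa [Function.comp_def] using
          h.comp_injective (mul_right_injective₀ (two_ne_zero (α := ℕ)))))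
      (fun n => by simp only [Finset.prod_range_succ]; linarith)
      (abs_le hμ hμi hr) (abs_le hν hνi fun n => by simpa only [heq] using hr n)
  have h2 : μ + μ = ν + ν := by rw [← map_sq_symmSqrt hμ, ← map_sq_symmSqrt hν, hsymm]
  ext s hs
  have h3 : μ s + μ s = ν s + ν s := by
    rw [← Measure.add_apply, ← Measure.add_apply, h2]
  rw [← two_mul, ← two_mul] at h3
  exact (ENNReal.mul_right_inj two_ne_zero (by simp)).1 h3

lemma not_summable_inv_mul_log {L : ℝ} (hL : 0 < L) :
    ¬ Summable fun n : ℕ => (L * (((n : ℝ) + 2) * Real.log (n + 2)))⁻¹ := by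
  have hlog (n : ℕ) : 0 < Real.log ((n : ℝ) + 2) :=
    Real.log_pos (by linarith [n.cast_nonneg (α := ℝ)])
  have step (n : ℕ) : Real.log (Real.log (((n + 1 : ℕ) : ℝ) + 2)) - Real.log (Real.log ((n : ℝ) + 2))
      ≤ (((n : ℝ) + 2) * Real.log (n + 2))⁻¹ := by
    have h0 := hlog n
    have hn : (0 : ℝ) < (n : ℝ) + 2 := by positivity
    rw [← Real.log_div (hlog (n + 1)).ne' h0.ne']
    refine (Real.log_le_sub_one_of_pos (div_pos (hlog (n + 1)) h0)).trans ?_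
    have h1 : Real.log (((n + 1 : ℕ) : ℝ) + 2) ≤ Real.log ((n : ℝ) + 2) + ((n : ℝ) + 2)⁻¹ := by
      have := Real.log_le_sub_one_of_pos (x := (((n + 1 : ℕ) : ℝ) + 2) / ((n : ℝ) + 2))
        (by positivity)
      rw [Real.log_div (by positivity) hn.ne'] at this
      have h2 : (((n + 1 : ℕ) : ℝ) + 2) / ((n : ℝ) + 2) - 1 = ((n : ℝ) + 2)⁻¹ := by
        push_cast; field_simp; ring
      linarith
    rw [div_sub_one h0.ne', mul_inv, ← div_eq_mul_inv]
    gcongr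
    linarith
  have hns : ¬ Summable fun n : ℕ => (((n : ℝ) + 2) * Real.log (n + 2))⁻¹ := by
    rw [not_summable_iff_tendsto_nat_atTop_of_nonneg
      fun n => inv_nonneg.2 (mul_nonneg (by positivity) (hlog n).le)]
    have hlim : Tendsto (fun n : ℕ => Real.log (Real.log ((n : ℝ) + 2)) - Real.log (Real.log 2))
        atTop atTop :=
      tendsto_atTop_add_const_right _ _ (Real.tendsto_log_atTop.comp (Real.tendsto_log_atTop.comp
        (tendsto_atTop_add_const_right _ _ tendsto_natCast_atTop_atTop)))
    refine tendsto_atTop_mono (fun n => ?_) hlim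
    have := Finset.sum_range_sub (fun n : ℕ => Real.log (Real.log ((n : ℝ) + 2))) n
    simp only [CharP.cast_eq_zero, zero_add] at this
    rw [← this]
    exact Finset.sum_le_sum fun k _ => step k
  intro h
  refine hns ((h.mul_left L).congr fun n => ?_)
  rw [mul_inv, mul_inv_cancel_left₀ hL.ne']

lemma lintegral_Ici_comp {ψ ψ' : ℝ → ℝ} {A : ℝ} (hψ : ∀ u ∈ Ici A, HasDerivAt ψ (ψ' u) u)
    (hpos : ∀ u ∈ Ici A, 0 < ψ' u) (htop : Tendsto ψ atTop atTop) (f : ℝ → ENNReal) :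
    ∫⁻ y in Ici (ψ A), f y = ∫⁻ u in Ici A, ENNReal.ofReal (ψ' u) * f (ψ u) := by
  have hcont : ContinuousOn ψ (Ici A) := fun u hu => (hψ u hu).continuousAt.continuousWithinAt
  have hmono : StrictMonoOn ψ (Ici A) := by
    refine strictMonoOn_of_deriv_pos (convex_Ici A) hcont fun u hu => ?_
    have hu' := interior_subset hu
    rw [(hψ u hu').deriv]
    exact hpos u hu'
  have himg : ψ '' Ici A = Ici (ψ A) := by
    refine Subset.antisymm ?_ fun y hy => ?_
    · rintro _ ⟨u, hu, rfl⟩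
      exact hmono.monotoneOn self_mem_Ici hu hu
    · obtain ⟨B, hB, hAB⟩ := ((htop.eventually_ge_atTop y).and (eventually_ge_atTop A)).exists
      obtain ⟨u, hu, rfl⟩ :=
        intermediate_value_Icc hAB (hcont.mono Icc_subset_Ici_self) ⟨hy, hB⟩
      exact ⟨u, hu.1, rfl⟩
  rw [← himg, lintegral_image_eq_lintegral_abs_deriv_mul measurableSet_Ici
    (fun u hu => (hψ u hu).hasDerivWithinAt) hmono.injOn]
  exact setLIntegral_congr_fun measurableSet_Ici fun u hu => by
    simp only [abs_of_pos (hpos u hu)]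

lemma setLIntegral_Ici_eq_of_restrict_eq {μ : Measure ℝ} {g : ℝ → ℝ} {x₀ a : ℝ}
    (hg : Measurable g)
    (hac : μ.restrict (Ici x₀) =
      (volume.restrict (Ici x₀)).withDensity (fun x => ENNReal.ofReal (g x)))
    (ha : x₀ ≤ a) {f : ℝ → ENNReal} (hf : Measurable f) :
    ∫⁻ y in Ici a, f y ∂μ = ∫⁻ y in Ici a, ENNReal.ofReal (g y) * f y := by
  have hsub : Ici a ⊆ Ici x₀ := Ici_subset_Ici.2 ha
  rw [← Measure.restrict_restrict_of_subset hsub, hac, restrict_withDensity measurableSet_Ici,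
    Measure.restrict_restrict_of_subset hsub,
    lintegral_withDensity_eq_lintegral_mul _ (by fun_prop) hf]
  rfl

/-- If the density contracts by `c` along `u² ↦ (T u)²`, tail moments contract along `A ↦ T A`. -/
lemma setLIntegral_pow_tail_le {μ : Measure ℝ} {g : ℝ → ℝ} {x₀ : ℝ} (hg : Measurable g)
    (hac : μ.restrict (Ici x₀) =
      (volume.restrict (Ici x₀)).withDensity (fun x => ENNReal.ofReal (g x)))
    (hg0 : ∀ x ∈ Ici x₀, 0 < g x) {T T' : ℝ → ℝ} {A c c' : ℝ} (hA : 0 < A) (hAx : x₀ ≤ A ^ 2)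
    (hT : ∀ u ∈ Ici A, HasDerivAt T (T' u) u) (hT' : ∀ u ∈ Ici A, 0 < T' u)
    (hTu : ∀ u ∈ Ici A, u ≤ T u) (hc : ∀ u ∈ Ici A, g (T u ^ 2) ≤ c * g (u ^ 2)) (hc' : 0 ≤ c')
    (n : ℕ) (hcT : ∀ u ∈ Ici A, c * (T u ^ (2 * n + 1) * T' u) ≤ c' * u ^ (2 * n + 1)) :
    ∫⁻ y in Ici (T A ^ 2), ENNReal.ofReal (y ^ n) ∂μ
      ≤ ENNReal.ofReal c' * ∫⁻ y in Ici (A ^ 2), ENNReal.ofReal (y ^ n) ∂μ := by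
  have hpos (u) (hu : u ∈ Ici A) : 0 < u := hA.trans_le hu
  have hTpos (u) (hu : u ∈ Ici A) : 0 < T u := (hpos u hu).trans_le (hTu u hu)
  have hTtop : Tendsto T atTop atTop :=
    tendsto_atTop_mono' _ ((eventually_ge_atTop A).mono fun u hu => hTu u hu) tendsto_id
  have hTA : A ≤ T A := hTu A self_mem_Ici
  rw [setLIntegral_Ici_eq_of_restrict_eq hg hac (hAx.trans (by gcongr)) (by fun_prop),
    setLIntegral_Ici_eq_of_restrict_eq hg hac hAx (by fun_prop),
    lintegral_Ici_comp (ψ := fun u => T u ^ 2) (ψ' := fun u => 2 * T u * T' u)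
      (fun u hu => by simpa using (hT u hu).fun_pow 2)
      (fun u hu => by have := hTpos u hu; have := hT' u hu; positivity)
      ((tendsto_pow_atTop two_ne_zero).comp hTtop),
    lintegral_Ici_comp (ψ := fun u => u ^ 2) (ψ' := fun u => 2 * u)
      (fun u hu => by simpa using (hasDerivAt_id' u).fun_pow 2)
      (fun u hu => by have := hpos u hu; positivity) (tendsto_pow_atTop two_ne_zero),
    ← lintegral_const_mul _ (by fun_prop)]
  refine setLIntegral_mono (by fun_prop) fun u hu => ?_
  have h1 := hpos u hu
  have h2 := hTpos u hu
  have h3 := hT' u hu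
  have h4 : 0 < g (u ^ 2) := hg0 _ (hAx.trans (by have : A ≤ u := hu; gcongr))
  have h5 : 0 < g (T u ^ 2) :=
    hg0 _ (hAx.trans (by have : A ≤ T u := le_trans hu (hTu u hu); gcongr))
  rw [← ENNReal.ofReal_mul h5.le, ← ENNReal.ofReal_mul (by positivity),
    ← ENNReal.ofReal_mul h4.le, ← ENNReal.ofReal_mul (by positivity), ← ENNReal.ofReal_mul hc']
  apply ENNReal.ofReal_le_ofReal
  calc 2 * T u * T' u * (g (T u ^ 2) * (T u ^ 2) ^ n)
      ≤ 2 * T u * T' u * (c * g (u ^ 2) * (T u ^ 2) ^ n) := by gcongr; exact hc u hu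
    _ = 2 * g (u ^ 2) * (c * (T u ^ (2 * n + 1) * T' u)) := by ring
    _ ≤ 2 * g (u ^ 2) * (c' * u ^ (2 * n + 1)) := 
        mul_le_mul_of_nonneg_left (hcT u hu) (by positivity)
    _ = _ := by ring

/-- A tail contraction at `B` bounds the ratio of consecutive moments by `B / (1 - c')`. -/
lemma integral_pow_succ_le_of_tail_le {μ : Measure ℝ} [IsProbabilityMeasure μ]
    (hsupp : μ (Iio 0) = 0) (hmom : ∀ n : ℕ, Integrable (fun x : ℝ => x ^ n) μ) {n : ℕ}
    {B c' : ℝ} {s : Set ℝ} (hB : 0 ≤ B) (hc' : 0 ≤ c')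
    (h : ∫⁻ y in Ici B, ENNReal.ofReal (y ^ (n + 1)) ∂μ
      ≤ ENNReal.ofReal c' * ∫⁻ y in s, ENNReal.ofReal (y ^ (n + 1)) ∂μ) :
    (1 - c') * ∫ x, x ^ (n + 1) ∂μ ≤ B * ∫ x, x ^ n ∂μ := by
  have hae : ∀ᵐ x ∂μ, 0 ≤ x := by
    rw [ae_iff]; simpa [Iio] using hsupp
  have hpow (k : ℕ) : ∀ᵐ x ∂μ, 0 ≤ x ^ k := hae.mono fun x hx => pow_nonneg hx k
  have htail : ∫ y in Ici B, y ^ (n + 1) ∂μ ≤ c' * ∫ y, y ^ (n + 1) ∂μ := by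
    have h' := h.trans (mul_le_mul_right (setLIntegral_le_lintegral s _) _)
    rw [← ofReal_integral_eq_lintegral_ofReal (hmom _).integrableOn
      (ae_restrict_of_ae (hpow _)), ← ofReal_integral_eq_lintegral_ofReal (hmom _) (hpow _),
      ← ENNReal.ofReal_mul hc'] at h'
    exact (ENNReal.ofReal_le_ofReal_iff
      (mul_nonneg hc' (integral_nonneg_of_ae (hpow _)))).1 h'
  have hhead : ∫ y in (Ici B)ᶜ, y ^ (n + 1) ∂μ ≤ B * ∫ y, y ^ n ∂μ := by
    rw [← integral_const_mul]
    refine (setIntegral_mono_on_ae (hmom _).integrableOn ((hmom n).const_mul B).integrableOn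
      measurableSet_Ici.compl (hae.mono fun x hx hxB => ?_)).trans
      (setIntegral_le_integral ((hmom n).const_mul B)
        ((hpow n).mono fun x hx => mul_nonneg hB hx))
    have : x ≤ B := (not_le.1 (show ¬ B ≤ x from hxB)).le
    rw [pow_succ']
    gcongr
  linarith [integral_add_compl (measurableSet_Ici (a := B)) (hmom (n + 1))]

/-- The shift `a (log u)^α log log u` is eventually below `log u`, with derivative tending to `0`. -/
lemma exists_deriv_log_shift {a α : ℝ} (ha : 0 < a) (hα : α ∈ Ico (0 : ℝ) 1) :
    ∃ φ' : ℝ → ℝ, ∀ η > 0, ∀ᶠ u in atTop,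
      HasDerivAt (fun u => a * Real.log u ^ α * Real.log (Real.log u)) (φ' u) u ∧
      0 ≤ φ' u ∧ φ' u ≤ η ∧ 0 ≤ a * Real.log u ^ α * Real.log (Real.log u) ∧
      a * Real.log u ^ α * Real.log (Real.log u) ≤ Real.log u := by
  obtain ⟨hα0, hα1⟩ := hα
  refine ⟨fun u => a * (u⁻¹ * α * Real.log u ^ (α - 1)) * Real.log (Real.log u)
    + a * Real.log u ^ α * (u⁻¹ / Real.log u), fun η hη => ?_⟩
  have h1 : ∀ᶠ u in atTop, 1 ≤ Real.log u := Real.tendsto_log_atTop.eventually_ge_atTop 1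
  have h2 : ∀ᶠ u in atTop, Real.log u ≤ (η / (2 * a)) * u := by
    filter_upwards [Real.isLittleO_log_id_atTop.bound (by positivity : 0 < η / (2 * a)),
      eventually_gt_atTop 0, h1] with u hu hu0 hl
    rwa [Real.norm_of_nonneg (by linarith), id, Real.norm_of_nonneg hu0.le] at hu
  have h3 : ∀ᶠ u in atTop, Real.log (Real.log u) ≤ a⁻¹ * Real.log u ^ (1 - α) := by
    have := Real.tendsto_log_atTop.eventually
      ((isLittleO_log_rpow_atTop (sub_pos.2 hα1)).bound (inv_pos.2 ha))
    filter_upwards [this, h1] with u hu hl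
    have h := (le_abs_self _).trans hu
    rwa [Real.norm_of_nonneg (by positivity)] at h
  filter_upwards [h1, h2, h3, eventually_gt_atTop 0] with u h1 h2 h3 hu
  have hl : 0 < Real.log u := by linarith
  have hll : 0 ≤ Real.log (Real.log u) := Real.log_nonneg h1
  refine ⟨?_, by positivity, ?_, by positivity, ?_⟩
  · exact (((Real.hasDerivAt_log hu.ne').rpow_const (Or.inl hl.ne')).const_mul a).mul
      ((Real.hasDerivAt_log hu.ne').log hl.ne')
  · have e1 : Real.log u ^ (α - 1) ≤ 1 := Real.rpow_le_one_of_one_le_of_nonpos h1 (by linarith)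
    have e2 : Real.log u ^ α ≤ Real.log u := by
      simpa using Real.rpow_le_rpow_of_exponent_le h1 hα1.le
    have e3 : Real.log (Real.log u) ≤ Real.log u := Real.log_le_self hl.le
    calc _ ≤ a * (u⁻¹ * 1 * 1) * Real.log u + a * Real.log u * (u⁻¹ / 1) := by gcongr
      _ = 2 * a * u⁻¹ * Real.log u := by ring
      _ ≤ 2 * a * u⁻¹ * (η / (2 * a) * u) := by gcongr
      _ = η := by field_simp
  · calc _ ≤ a * Real.log u ^ α * (a⁻¹ * Real.log u ^ (1 - α)) := by gcongr
      _ = Real.log u ^ α * Real.log u ^ (1 - α) := by field_simp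
      _ = Real.log u := by rw [← Real.rpow_add hl]; simp

/-- Beyond `K m log m` with `K` large, `m log u / u` is uniformly small. -/
lemma exists_scale_mul_log_le {δ : ℝ} (hδ : 0 < δ) (A₀ : ℝ) :
    ∃ K > 0, ∀ m : ℝ, 2 ≤ m → A₀ ≤ K * (m * Real.log m) ∧
      ∀ u, K * (m * Real.log m) ≤ u → 2 * m * Real.log u ≤ δ * u := by
  have hK : ∀ᶠ K in atTop, Real.log K ≤ δ / 8 * K := by
    filter_upwards [Real.isLittleO_log_id_atTop.bound (by positivity : 0 < δ / 8),
      eventually_gt_atTop 0] with K hK hK0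
    have := (le_abs_self _).trans hK
    rwa [id, Real.norm_of_nonneg hK0.le] at this
  obtain ⟨K, hK, hK1, hKA, hKδ⟩ := (hK.and ((eventually_ge_atTop 3).and
    ((eventually_ge_atTop A₀).and (eventually_ge_atTop (8 / δ))))).exists
  have hK0 : 0 < K := by linarith
  refine ⟨K, hK0, fun m hm => ?_⟩
  have hm0 : 0 < m := by linarith
  have hlm : 1 / 2 ≤ Real.log m := by
    have := Real.log_le_log two_pos hm
    linarith [Real.log_two_gt_d9]
  have hlog1 : 1 ≤ m * Real.log m := by nlinarith
  have hKU : K ≤ K * (m * Real.log m) := le_mul_of_one_le_right hK0.le hlog1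
  have hU : 0 < K * (m * Real.log m) := by positivity
  refine ⟨hKA.trans hKU, fun u hu => ?_⟩
  have he : Real.exp 1 ≤ K * (m * Real.log m) := by linarith [Real.exp_one_lt_three]
  have hu0 : 0 < u := hU.trans_le hu
  have hanti := Real.log_div_self_antitoneOn he (he.trans hu) hu
  simp only at hanti
  have hlogU : Real.log (K * (m * Real.log m)) ≤ δ / 2 * K * Real.log m := by
    rw [Real.log_mul hK0.ne' (by positivity), Real.log_mul hm0.ne' (by positivity)]
    have h1 : Real.log (Real.log m) ≤ Real.log m := Real.log_le_self (by linarith)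
    have h2 : 1 ≤ δ / 8 * K := by
      have := (div_le_iff₀ hδ).1 hKδ
      linarith
    nlinarith
  have h3 : Real.log u ≤ δ / (2 * m) * u := by
    rw [← div_le_iff₀ hu0]
    refine hanti.trans ?_
    rw [div_le_iff₀ hU]
    refine hlogU.trans_eq ?_
    field_simp
  calc 2 * m * Real.log u ≤ 2 * m * (δ / (2 * m) * u) := by gcongr
    _ = δ * u := by field_simp

/-- The moment ratios of a distribution whose density contracts by a factor `< 1` along
`u² ↦ (u + φ u)²` with `φ ≤ log`. -/
lemma exists_moment_ratio_le {μ : Measure ℝ} [IsProbabilityMeasure μ] (hsupp : μ (Iio 0) = 0)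
    (hmom : ∀ n : ℕ, Integrable (fun x : ℝ => x ^ n) μ) {g : ℝ → ℝ} {x₀ : ℝ} (hg : Measurable g)
    (hac : μ.restrict (Ici x₀) =
      (volume.restrict (Ici x₀)).withDensity (fun x => ENNReal.ofReal (g x)))
    (hg0 : ∀ x ∈ Ici x₀, 0 < g x) {φ φ' : ℝ → ℝ} {δ : ℝ} (hδ : 0 < δ)
    (hφ : ∀ᶠ u in atTop, HasDerivAt φ (φ' u) u ∧ 0 ≤ φ' u ∧ φ' u ≤ δ ∧ 0 ≤ φ u ∧ φ u ≤ Real.log u)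
    (hc : ∀ᶠ u in atTop, g ((u + φ u) ^ 2) ≤ Real.exp (-(3 * δ)) * g (u ^ 2)) :
    ∃ L > 0, ∀ n : ℕ, ∫ x, x ^ (n + 1) ∂μ
      ≤ (L * (((n : ℝ) + 2) * Real.log (n + 2))) ^ 2 * ∫ x, x ^ n ∂μ := by
  obtain ⟨A₀, hA₀⟩ := eventually_atTop.1 (hφ.and (hc.and (eventually_ge_atTop (max 1 x₀))))
  obtain ⟨K, hK, hKm⟩ := exists_scale_mul_log_le hδ A₀
  have hδ1 : 0 < 1 - Real.exp (-δ) := by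
    have : Real.exp (-δ) < 1 := by simpa using hδ
    linarith
  refine ⟨2 * K / Real.sqrt (1 - Real.exp (-δ)), by positivity, fun n => ?_⟩
  obtain ⟨hUA, hUu⟩ := hKm (n + 2) (by linarith [n.cast_nonneg (α := ℝ)])
  set U : ℝ := K * (((n : ℝ) + 2) * Real.log (n + 2)) with hUdef
  have hprop (u) (hu : u ∈ Ici U) := hA₀ u (hUA.trans hu)
  have hone (u) (hu : u ∈ Ici U) : 1 ≤ u := (le_max_left _ _).trans (hprop u hu).2.2
  have hU1 : 1 ≤ U := hone U self_mem_Ici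
  have htail := setLIntegral_pow_tail_le hg hac hg0 (T := fun u => u + φ u)
    (T' := fun u => 1 + φ' u) (A := U) (c := Real.exp (-(3 * δ))) (c' := Real.exp (-δ))
    (by linarith)
    (by
      have := (le_max_right _ _).trans (hprop U self_mem_Ici).2.2
      nlinarith)
    (fun u hu => (hasDerivAt_id' u).add (hprop u hu).1.1)
    (fun u hu => by linarith [(hprop u hu).1.2.1])
    (fun u hu => by linarith [(hprop u hu).1.2.2.2.1])
    (fun u hu => (hprop u hu).2.1) (Real.exp_pos _).le (n + 1)
    (fun u hu => by
      obtain ⟨⟨-, h1, h2, h3, h4⟩, -⟩ := hprop u hu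
      have hu0 : 0 < u := by linarith [hone u hu]
      have hstep : u + φ u ≤ u * Real.exp (Real.log u / u) := by
        have := Real.add_one_le_exp (Real.log u / u)
        calc u + φ u ≤ u + Real.log u := by linarith
          _ = u * (Real.log u / u + 1) := by field_simp; ring
          _ ≤ _ := by gcongr
      have hexp : Real.exp (Real.log u / u) ^ (2 * (n + 1) + 1) ≤ Real.exp δ := by
        rw [← Real.exp_nat_mul, Real.exp_le_exp, ← mul_div_assoc, div_le_iff₀ hu0]
        have := hUu u hu
        have hl : 0 ≤ Real.log u := Real.log_nonneg (hone u hu)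
        push_cast
        nlinarith
      have hd : 1 + φ' u ≤ Real.exp δ := by linarith [Real.add_one_le_exp δ]
      calc Real.exp (-(3 * δ)) * ((u + φ u) ^ (2 * (n + 1) + 1) * (1 + φ' u))
          ≤ Real.exp (-(3 * δ)) *
            ((u * Real.exp (Real.log u / u)) ^ (2 * (n + 1) + 1) * Real.exp δ) := by gcongr
        _ ≤ Real.exp (-(3 * δ)) * (u ^ (2 * (n + 1) + 1) * Real.exp δ * Real.exp δ) := by
            rw [mul_pow]; gcongr
        _ = Real.exp (-(3 * δ) + δ + δ) * u ^ (2 * (n + 1) + 1) := by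
            rw [Real.exp_add, Real.exp_add]; ring
        _ = _ := by ring_nf)
  have hratio := integral_pow_succ_le_of_tail_le hsupp hmom (sq_nonneg _) (Real.exp_pos _).le htail
  have hTU : (U + φ U) ^ 2 ≤ (2 * U) ^ 2 := by
    obtain ⟨⟨-, -, -, h3, h4⟩, -⟩ := hprop U self_mem_Ici
    have := Real.log_le_self (by linarith : 0 ≤ U)
    gcongr
    linarith
  have hI : 0 ≤ ∫ x, x ^ n ∂μ := by
    refine integral_nonneg_of_ae ?_
    have hae : ∀ᵐ x ∂μ, 0 ≤ x := by
      rw [ae_iff]; simpa [Iio] using hsupp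
    exact hae.mono fun x hx => pow_nonneg hx n
  have hfin : (1 - Real.exp (-δ)) * ∫ x, x ^ (n + 1) ∂μ ≤ (2 * U) ^ 2 * ∫ x, x ^ n ∂μ :=
    hratio.trans (by gcongr)
  rw [mul_comm, ← le_div_iff₀ hδ1] at hfin
  refine hfin.trans_eq ?_
  rw [div_mul_eq_mul_div, div_pow, Real.sq_sqrt hδ1.le, hUdef]
  ring

/-- Corollary 6: if `limsup_{x→∞} g((x + a (log x)^α · log log x)²)/g(x²) < 1`
with `a > 0`, `α ∈ [0,1)`, `x₀ > e`, then `G` is M-det on `[0,∞)`. -/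
theorem corollary6
    (x₀ : ℝ) (hx₀ : Real.exp 1 < x₀)
    (a α : ℝ) (ha : 0 < a) (hα : α ∈ Ico (0 : ℝ) 1)
    (μ : Measure ℝ) [IsProbabilityMeasure μ]
    (hsupp : μ (Iio 0) = 0)
    (hmom : ∀ n : ℕ, Integrable (fun x => x ^ n) μ)
    (g : ℝ → ℝ) (hg_meas : Measurable g)
    (hg_ac : μ.restrict (Ici x₀) =
      (volume.restrict (Ici x₀)).withDensity (fun x => ENNReal.ofReal (g x)))
    (hg_pos : ∀ x ∈ Ici x₀, 0 < g x)
    (hlimsup : Filter.limsup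
        (fun x => ENNReal.ofReal
          (g ((x + a * (Real.log x) ^ α * Real.log (Real.log x)) ^ 2) / g (x ^ 2)))
        atTop < 1) :
    IsMomentDetOnNonneg μ := by
  intro ν hν hν0 hνm
  obtain ⟨φ', hφ'⟩ := exists_deriv_log_shift ha hα
  obtain ⟨c, hc, hc1⟩ := exists_between hlimsup
  have hcr : c.toReal < 1 := by
    simpa using (ENNReal.toReal_lt_toReal hc1.ne_top ENNReal.one_ne_top).2 hc1
  set r := max c.toReal (1 / 2) with hr
  have hr0 : 0 < r := lt_max_of_lt_right (by norm_num)
  have hr1 : r < 1 := max_lt hcr (by norm_num)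
  have hδ : 0 < -Real.log r / 3 := by linarith [Real.log_neg hr0 hr1]
  have hcontr : ∀ᶠ u in atTop,
      g ((u + a * Real.log u ^ α * Real.log (Real.log u)) ^ 2)
        ≤ Real.exp (-(3 * (-Real.log r / 3))) * g (u ^ 2) := by
    filter_upwards [eventually_lt_of_limsup_lt hc, eventually_ge_atTop (max 1 x₀)] with u hu hux
    have hgu : 0 < g (u ^ 2) := hg_pos _ (by
      have h1 := (le_max_left _ _).trans hux
      have h2 := (le_max_right _ _).trans hux
      simp only [mem_Ici]
      nlinarith)
    rw [show -(3 * (-Real.log r / 3)) = Real.log r by ring, Real.exp_log hr0,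
      ← div_le_iff₀ hgu]
    exact ((ENNReal.ofReal_le_iff_le_toReal hc1.ne_top).1 hu.le).trans (le_max_left _ _)
  obtain ⟨L, hL, hLn⟩ := exists_moment_ratio_le hsupp hmom hg_meas hg_ac hg_pos hδ
    (hφ' _ hδ) hcontr
  have hlog (n : ℕ) : 0 < Real.log ((n : ℝ) + 2) :=
    Real.log_pos (by linarith [n.cast_nonneg (α := ℝ)])
  refine (ext_of_moment_ratio_le hsupp hν0 hmom (fun n => ?_) (fun n => ?_)
    (w := fun n => L * (((n : ℝ) + 2) * Real.log (n + 2)))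
    (fun n => by have := hlog n; positivity) (fun m n hmn => ?_)
    (not_summable_inv_mul_log hL) hLn).symm
  · rcases n.eq_zero_or_pos with rfl | hn
    · simp
    · exact (hνm n hn).1
  · rcases n.eq_zero_or_pos with rfl | hn
    · simp
    · exact (hνm n hn).2.symm
  · have := (hlog m).le
    dsimp only
    gcongr
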